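/- For integers i ≥ 1 and 1 ≤ t ≤ n, a_i(n,0,t) = δ_{n,t} + Σ_{ℓ=1}^{n−t} (binomial(ℓ+t−1, ℓ) − 1)·a_{i−1}(n−t, 0, ℓ), where a_0(n', 0, ℓ) is defined to be 0 for all n', ℓ. -/

import Mathlib

/-- A Catalan word: a word `a : Fin n → ℕ` satisfying (i) `a (i+1) ≥ a i - 1` for all
adjacent positions, and (ii) if `i` is the minimal index with `a i = k > 0`, then there
exist `i₁ < i < i₂` with `a i₁ = a i₂ = k - 1`. -/
def IsCatalanWord {n : ℕ} (a : Fin n → ℕ) : Prop :=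
  (∀ (i : ℕ) (h : i + 1 < n), a ⟨i, Nat.lt_of_succ_lt h⟩ ≤ a ⟨i + 1, h⟩ + 1) ∧
  (∀ i : Fin n, 0 < a i → (∀ j : Fin n, a j = a i → i ≤ j) →
    ((∃ i₁ : Fin n, i₁ < i ∧ a i₁ + 1 = a i) ∧ (∃ i₂ : Fin n, i < i₂ ∧ a i₂ + 1 = a i)))

/-- The number of letters of the word `a` equal to `c`. -/
noncomputable def countEq {n : ℕ} (a : Fin n → ℕ) (c : ℕ) : ℕ :=
  Set.ncard {i : Fin n | a i = c}

/-- `numLet i n s t` is the number of Catalan words of length `n` containing exactly `s`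
letters equal to `i` and exactly `t` letters equal to `0`. -/
noncomputable def numLet (i n s t : ℕ) : ℕ :=
  Set.ncard {a : Fin n → ℕ | IsCatalanWord a ∧ countEq a i = s ∧ countEq a 0 = t}

/-- Adjacent letters of the list descend by at most one. -/
abbrev UnitDescents (L : List ℕ) : Prop :=
  L.IsChain (fun x y => x ≤ y + 1)

/-- The list version of `IsCatalanWord`. -/
def IsCatalanList (L : List ℕ) : Prop :=
  UnitDescents L ∧
    ∀ (u v : List ℕ) (k : ℕ), L = u ++ (k + 1) :: v → k + 1 ∉ u → k ∈ u ∧ k ∈ v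

/-- Delete the zeros of a list and decrease all other letters by one. -/
def lowerNonzero (L : List ℕ) : List ℕ := L.filterMap Nat.ppred

@[simp] lemma lowerNonzero_nil : lowerNonzero [] = [] := rfl

@[simp] lemma lowerNonzero_zero_cons (L : List ℕ) :
    lowerNonzero (0 :: L) = lowerNonzero L := rfl

@[simp] lemma lowerNonzero_succ_cons (k : ℕ) (L : List ℕ) :
    lowerNonzero ((k + 1) :: L) = k :: lowerNonzero L := rfl

@[simp] lemma lowerNonzero_append (L M : List ℕ) :
    lowerNonzero (L ++ M) = lowerNonzero L ++ lowerNonzero M :=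
  List.filterMap_append

@[simp] lemma mem_lowerNonzero {k : ℕ} {L : List ℕ} : k ∈ lowerNonzero L ↔ k + 1 ∈ L := by
  induction L with
  | nil => simp
  | cons x L ih => cases x <;> simp [ih]

@[simp] lemma lowerNonzero_map_succ (L : List ℕ) : lowerNonzero (L.map Nat.succ) = L := by
  induction L with
  | nil => rfl
  | cons x L ih => simpa using ih

@[simp] lemma lowerNonzero_replicate_zero (t : ℕ) : lowerNonzero (List.replicate t 0) = [] := by
  induction t with
  | zero => rfl
  | succ t ih => simpa [List.replicate_succ] using ih

lemma count_lowerNonzero (k : ℕ) (L : List ℕ) :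
    (lowerNonzero L).count k = L.count (k + 1) := by
  induction L with
  | nil => simp
  | cons x L ih => cases x <;> simp [List.count_cons, ih]

lemma length_eq_count_zero_add_length_lowerNonzero (L : List ℕ) :
    L.length = L.count 0 + (lowerNonzero L).length := by
  induction L with
  | nil => simp
  | cons x L ih => cases x <;> simp [ih] <;> omega

lemma map_succ_lowerNonzero_of_count_eq_zero {L : List ℕ} (h : L.count 0 = 0) :
    (lowerNonzero L).map Nat.succ = L := by
  induction L with
  | nil => rfl
  | cons x L ih =>
    cases x with
    | zero => simp at h
    | succ x =>
      simp only [List.count_cons] at h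
      simpa using ih (by simpa using h)

lemma eq_replicate_of_lowerNonzero_eq_nil {L : List ℕ} (h : lowerNonzero L = []) :
    L = List.replicate (L.count 0) 0 := by
  induction L with
  | nil => rfl
  | cons x L ih =>
    cases x with
    | zero =>
      have := ih (by simpa using h)
      simp only [List.count_cons_self, List.replicate_succ]
      rw [← this]
    | succ x => simp at h

lemma unitDescents_zero_cons {L : List ℕ} : UnitDescents (0 :: L) ↔ UnitDescents L := by
  cases L <;> simp [UnitDescents]

lemma unitDescents_succ_map_succ {p : ℕ} {L : List ℕ} :
    UnitDescents ((p + 1) :: L.map Nat.succ) ↔ UnitDescents (p :: L) := by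
  rw [UnitDescents, show (p + 1) :: L.map Nat.succ = (p :: L).map Nat.succ from rfl,
    List.isChain_map]
  simp [UnitDescents]

lemma UnitDescents.cons_map_succ_lowerNonzero {p : ℕ} {L : List ℕ} (h : UnitDescents (p :: L)) :
    UnitDescents (p :: (lowerNonzero L).map Nat.succ) := by
  induction L generalizing p with
  | nil => simp [UnitDescents]
  | cons x L ih =>
    rw [UnitDescents, List.isChain_cons_cons] at h
    have hL := ih h.2
    cases x with
    | zero =>
      rw [lowerNonzero_zero_cons]
      rw [unitDescents_zero_cons] at hL
      refine List.isChain_cons.2 ⟨fun y hy => ?_, hL⟩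
      have := h.1
      omega
    | succ x => exact List.isChain_cons_cons.2 ⟨h.1, hL⟩

lemma UnitDescents.lowerNonzero {L : List ℕ} (h : UnitDescents L) :
    UnitDescents (lowerNonzero L) := by
  have := (unitDescents_zero_cons.2 h).cons_map_succ_lowerNonzero
  rw [unitDescents_zero_cons, UnitDescents, List.isChain_map] at this
  simpa [UnitDescents] using this

/-- The lists obtained from `b` by raising its letters and inserting `t` zeros, such that
adjacent letters descend by at most one even when preceded by the letter `p`. -/
def zeroInsertions (p : ℕ) (b : List ℕ) (t : ℕ) : Set (List ℕ) :=
  {a | lowerNonzero a = b ∧ a.count 0 = t ∧ UnitDescents (p :: a)}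

lemma cons_mem_zeroInsertions_iff {p x t : ℕ} {a b : List ℕ} :
    (x :: a) ∈ zeroInsertions p b t ↔ p ≤ x + 1 ∧
      ((x = 0 ∧ ∃ s, t = s + 1 ∧ a ∈ zeroInsertions 0 b s) ∨
        ∃ y b', x = y + 1 ∧ b = y :: b' ∧ a ∈ zeroInsertions (y + 1) b' t) := by
  cases x with
  | zero =>
    simp only [zeroInsertions, Set.mem_ofPred_eq, UnitDescents, List.isChain_cons_cons,
      lowerNonzero_zero_cons, List.count_cons_self]
    constructor
    · rintro ⟨h1, h2, h3, h4⟩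
      exact ⟨h3, Or.inl ⟨trivial, _, h2.symm, h1, rfl, h4⟩⟩
    · rintro ⟨h3, ⟨-, s, rfl, h1, rfl, h4⟩ | ⟨y, b', h, -⟩⟩
      · exact ⟨h1, rfl, h3, h4⟩
      · omega
  | succ x =>
    simp only [zeroInsertions, Set.mem_ofPred_eq, UnitDescents, List.isChain_cons_cons,
      lowerNonzero_succ_cons]
    constructor
    · rintro ⟨h1, h2, h3, h4⟩
      exact ⟨h3, Or.inr ⟨x, _, rfl, h1.symm, rfl, by simpa using h2, h4⟩⟩
    · rintro ⟨h3, ⟨h, -⟩ | ⟨y, b', h, rfl, h1, h2, h4⟩⟩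
      · omega
      · obtain rfl : x = y := by omega
        exact ⟨by rw [h1], by simpa using h2, h3, h4⟩

lemma zeroInsertions_nil {p t : ℕ} (h : p ≤ 1 ∨ t = 0) :
    zeroInsertions p [] t = {List.replicate t 0} := by
  ext a
  simp only [zeroInsertions, Set.mem_ofPred_eq, Set.mem_singleton_iff]
  constructor
  · rintro ⟨h1, rfl, -⟩
    exact eq_replicate_of_lowerNonzero_eq_nil h1
  · rintro rfl
    refine ⟨by simp, by simp, List.isChain_cons.2 ⟨fun y hy => ?_, ?_⟩⟩
    · rcases h with h | rfl
      · omega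
      · simp at hy
    · exact List.isChain_replicate_of_rel _ (by simp)

lemma zeroInsertions_nil_of_two_le {p t : ℕ} (hp : 2 ≤ p) :
    zeroInsertions p [] (t + 1) = ∅ := by
  ext a
  cases a with
  | nil => simp [zeroInsertions]
  | cons x a =>
    rw [cons_mem_zeroInsertions_iff]
    simp only [Set.mem_empty_iff_false, iff_false]
    rintro ⟨h, ⟨rfl, -⟩ | ⟨y, b', -, hb, -⟩⟩
    · omega
    · simp at hb

lemma zeroInsertions_cons_of_two_le_or {p x t : ℕ} {b : List ℕ} (h : 2 ≤ p ∨ t = 0)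
    (hp : p ≤ x + 2) :
    zeroInsertions p (x :: b) t = List.cons (x + 1) '' zeroInsertions (x + 1) b t := by
  ext a
  cases a with
  | nil => simp [zeroInsertions]
  | cons y a =>
    rw [cons_mem_zeroInsertions_iff]
    simp only [Set.mem_image, List.cons.injEq]
    constructor
    · rintro ⟨h, ⟨rfl, _, rfl, -⟩ | ⟨y, b', rfl, ⟨rfl, rfl⟩, ha⟩⟩
      · omega
      · exact ⟨a, ha, rfl, rfl⟩
    · rintro ⟨a, ha, rfl, rfl⟩
      exact ⟨by omega, Or.inr ⟨x, b, rfl, ⟨rfl, rfl⟩, ha⟩⟩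

lemma zeroInsertions_cons_of_le_one {p x t : ℕ} {b : List ℕ} (hp : p ≤ 1) :
    zeroInsertions p (x :: b) (t + 1) = List.cons 0 '' zeroInsertions 0 (x :: b) t ∪
      List.cons (x + 1) '' zeroInsertions (x + 1) b (t + 1) := by
  ext a
  cases a with
  | nil => simp [zeroInsertions]
  | cons y a =>
    rw [cons_mem_zeroInsertions_iff]
    simp only [Set.mem_union, Set.mem_image, List.cons.injEq]
    constructor
    · rintro ⟨h, ⟨rfl, s, hs, ha⟩ | ⟨y, b', rfl, ⟨rfl, rfl⟩, ha⟩⟩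
      · obtain rfl : t = s := by omega
        exact Or.inl ⟨a, ha, rfl, rfl⟩
      · exact Or.inr ⟨a, ha, rfl, rfl⟩
    · rintro (⟨a, ha, rfl, rfl⟩ | ⟨a, ha, rfl, rfl⟩)
      · exact ⟨by omega, Or.inl ⟨rfl, t, rfl, ha⟩⟩
      · exact ⟨by omega, Or.inr ⟨x, b, rfl, ⟨rfl, rfl⟩, ha⟩⟩

lemma encard_zeroInsertions {p t : ℕ} {b : List ℕ} (h : UnitDescents (p :: b.map Nat.succ)) :
    (zeroInsertions p b t).encard =
      Nat.multichoose (b.count 0 + if p ≤ 1 then 1 else 0) t := by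
  induction b generalizing p t with
  | nil =>
    by_cases hp : p ≤ 1
    · simp [zeroInsertions_nil (Or.inl hp), hp, Nat.multichoose_one]
    · cases t with
      | zero => simp [zeroInsertions_nil]
      | succ t => simp [zeroInsertions_nil_of_two_le (not_le.1 hp), hp]
  | cons x b ihb =>
    have hpx := (List.isChain_cons_cons.1 h).1
    have hx := (List.isChain_cons_cons.1 h).2
    have hcount : (x :: b).count 0 = b.count 0 + if x + 1 ≤ 1 then 1 else 0 := by
      simp [List.count_cons]
    have hcons (y : ℕ) : Function.Injective (List.cons y) := List.cons_injective
    by_cases hp : p ≤ 1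
    · induction t generalizing p with
      | zero =>
        rw [zeroInsertions_cons_of_two_le_or (Or.inr rfl) (by omega), (hcons _).encard_image,
          ihb hx]
        simp
      | succ t iht =>
        have h0 : UnitDescents (0 :: (x :: b).map Nat.succ) := unitDescents_zero_cons.2 hx
        rw [zeroInsertions_cons_of_le_one hp, Set.encard_union_eq, (hcons _).encard_image,
          (hcons _).encard_image, ihb hx, iht h0 (by omega) (by omega), hcount]
        · simp only [hp, if_true, Nat.zero_le]
          rw [Nat.multichoose_succ_succ]
          push_cast
          rw [add_comm]
        · rw [Set.disjoint_left]
          rintro _ ⟨a, -, rfl⟩ ⟨a', -, h'⟩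
          simp at h'
    · rw [zeroInsertions_cons_of_two_le_or (Or.inl (by omega)) (by omega),
        (hcons _).encard_image, ihb hx, hcount]
      simp [hp]

lemma exists_eq_append_of_lowerNonzero_eq {a u v : List ℕ} {k : ℕ}
    (h : lowerNonzero a = u ++ k :: v) :
    ∃ U V, a = U ++ (k + 1) :: V ∧ lowerNonzero U = u ∧ lowerNonzero V = v := by
  induction a generalizing u with
  | nil => simp at h
  | cons x a ih =>
    cases x with
    | zero =>
      obtain ⟨U, V, rfl, hU, hV⟩ := ih (by simpa using h)
      exact ⟨0 :: U, V, rfl, by simpa using hU, hV⟩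
    | succ x =>
      cases u with
      | nil =>
        simp only [lowerNonzero_succ_cons, List.nil_append, List.cons.injEq] at h
        obtain ⟨rfl, rfl⟩ := h
        exact ⟨[], a, rfl, rfl, rfl⟩
      | cons y u =>
        simp only [lowerNonzero_succ_cons, List.cons_append, List.cons.injEq] at h
        obtain ⟨rfl, h⟩ := h
        obtain ⟨U, V, rfl, hU, hV⟩ := ih h
        exact ⟨(x + 1) :: U, V, rfl, by simp [hU], hV⟩

lemma IsCatalanList.head_eq_zero {x : ℕ} {L : List ℕ} (h : IsCatalanList (x :: L)) : x = 0 := by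
  cases x with
  | zero => rfl
  | succ k => simpa using (h.2 [] L k rfl (by simp)).1

lemma IsCatalanList.lowerNonzero {a : List ℕ} (h : IsCatalanList a) :
    IsCatalanList (lowerNonzero a) := by
  refine ⟨h.1.lowerNonzero, fun u v k huv hk => ?_⟩
  obtain ⟨U, V, rfl, rfl, rfl⟩ := exists_eq_append_of_lowerNonzero_eq huv
  simpa using h.2 U V (k + 1) rfl (by simpa using hk)

lemma isCatalanList_zero_cons_iff {a b : List ℕ} (hb : IsCatalanList b) (hne : b ≠ [])
    (hab : lowerNonzero a = b) :
    IsCatalanList (0 :: a) ↔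
      UnitDescents (0 :: a) ∧ a ≠ List.replicate (a.count 0) 0 ++ b.map Nat.succ := by
  obtain ⟨x, b, rfl⟩ := List.exists_cons_of_ne_nil hne
  obtain rfl := hb.head_eq_zero
  constructor
  · refine fun h => ⟨h.1, fun ha => ?_⟩
    have := (h.2 (0 :: List.replicate (a.count 0) 0) (b.map Nat.succ) 0
      (by rw [List.cons_append]; exact congrArg _ ha) (by simp [List.mem_replicate])).2
    simp at this
  · rintro ⟨hd, ha⟩
    refine ⟨hd, fun u v k huv hk => ?_⟩
    have hlow : 0 :: b = lowerNonzero u ++ k :: lowerNonzero v := by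
      rw [← hab, ← lowerNonzero_zero_cons, huv]
      simp
    cases k with
    | succ k => simpa using hb.2 _ _ k hlow (by simpa using hk)
    | zero =>
      cases u with
      | nil => simp at huv
      | cons y u =>
        simp only [List.cons_append, List.cons.injEq] at huv
        obtain ⟨rfl, rfl⟩ := huv
        refine ⟨by simp, by_contra fun hv => ha ?_⟩
        have hu : lowerNonzero u = [] := by
          rw [lowerNonzero_zero_cons] at hlow
          cases hu : lowerNonzero u with
          | nil => rfl
          | cons z w =>
            rw [hu] at hlow
            obtain rfl : 0 = z := (List.cons.inj hlow).1
            refine absurd ?_ hk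
            rw [List.mem_cons, ← mem_lowerNonzero, hu]
            simp
        have hv' := map_succ_lowerNonzero_of_count_eq_zero (List.count_eq_zero.2 hv)
        have hu' := eq_replicate_of_lowerNonzero_eq_nil hu
        have hb' : lowerNonzero v = b := by simpa [hu] using hab
        rw [hb'] at hv'
        rw [hu']
        simp [List.count_eq_zero.2 hv, hv']

lemma fiber_lowerNonzero_eq {b : List ℕ} (hb : IsCatalanList b) (hne : b ≠ []) (t : ℕ) :
    {a | IsCatalanList a ∧ lowerNonzero a = b ∧ a.count 0 = t + 1} =
      List.cons 0 '' (zeroInsertions 0 b t \ {List.replicate t 0 ++ b.map Nat.succ}) := by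
  ext a
  cases a with
  | nil => simp
  | cons x a =>
    simp only [Set.mem_ofPred_eq, Set.mem_image, List.cons.injEq, Set.mem_sdiff,
      Set.mem_singleton_iff, zeroInsertions]
    constructor
    · rintro ⟨h1, h2, h3⟩
      obtain rfl := h1.head_eq_zero
      rw [lowerNonzero_zero_cons] at h2
      rw [isCatalanList_zero_cons_iff hb hne h2] at h1
      obtain rfl : a.count 0 = t := by simpa using h3
      exact ⟨a, ⟨⟨h2, rfl, h1.1⟩, h1.2⟩, rfl, rfl⟩
    · rintro ⟨a, ⟨⟨h2, rfl, h1⟩, h3⟩, rfl, rfl⟩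
      exact ⟨(isCatalanList_zero_cons_iff hb hne h2).2 ⟨h1, h3⟩, by simpa using h2, by simp⟩

lemma encard_fiber_lowerNonzero {b : List ℕ} (hb : IsCatalanList b) (hne : b ≠ []) (t : ℕ) :
    {a | IsCatalanList a ∧ lowerNonzero a = b ∧ a.count 0 = t + 1}.encard =
      ((b.count 0 + t).choose (b.count 0) - 1 : ℕ) := by
  have hraise : UnitDescents (b.map Nat.succ) := by
    rw [UnitDescents, List.isChain_map]
    simpa [UnitDescents] using hb.1
  have hmem : List.replicate t 0 ++ b.map Nat.succ ∈ zeroInsertions 0 b t := by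
    refine ⟨by simp, by simp [List.count_eq_zero], ?_⟩
    rw [unitDescents_zero_cons]
    induction t with
    | zero => simpa using hraise
    | succ t ih =>
      rw [List.replicate_succ, List.cons_append, unitDescents_zero_cons]
      exact ih
  rw [fiber_lowerNonzero_eq hb hne, List.cons_injective.encard_image,
    Set.encard_sdiff_singleton_of_mem hmem,
    encard_zeroInsertions (unitDescents_zero_cons.2 hraise), if_pos (Nat.zero_le 1),
    Nat.multichoose_eq, show b.count 0 + 1 + t - 1 = b.count 0 + t by omega,
    ← Nat.choose_symm_add]
  norm_cast

lemma IsCatalanList.mem_of_le {L : List ℕ} (h : IsCatalanList L) {k j : ℕ} (hk : k ∈ L)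
    (hj : j ≤ k) : j ∈ L := by
  induction k with
  | zero => simpa [Nat.le_zero.1 hj] using hk
  | succ k ih =>
    rcases Nat.le_succ_iff.1 hj with hj | rfl
    · obtain ⟨u, v, rfl, hu⟩ := List.eq_append_cons_of_mem hk
      exact ih (List.mem_append_left _ (h.2 u v k rfl hu).1) hj
    · exact hk

lemma IsCatalanList.lt_length {L : List ℕ} (h : IsCatalanList L) {k : ℕ} (hk : k ∈ L) :
    k < L.length := by
  have hsub : Finset.range (k + 1) ⊆ L.toFinset := fun j hj =>
    List.mem_toFinset.2 (h.mem_of_le hk (by simpa [Nat.lt_succ_iff] using hj))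
  have := (Finset.card_le_card hsub).trans L.toFinset_card_le
  simpa [Nat.succ_le_iff] using this

lemma finite_isCatalanList (n : ℕ) : {L | IsCatalanList L ∧ L.length = n}.Finite := by
  refine ((List.finite_length_eq (Fin n) n).image (List.map Fin.val)).subset ?_
  rintro L ⟨hL, rfl⟩
  exact ⟨L.pmap Fin.mk fun k hk => hL.lt_length hk, by simp, by simp [List.map_pmap]⟩

lemma isCatalanWord_iff {n : ℕ} (a : Fin n → ℕ) :
    IsCatalanWord a ↔ IsCatalanList (List.ofFn a) := by
  rw [IsCatalanWord, IsCatalanList, UnitDescents, List.isChain_iff_getElem]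
  refine and_congr (by simp) ⟨fun h u v k huv hk => ?_, fun h i hi hmin => ?_⟩
  · have hlen : u.length + (v.length + 1) = n := by
      simpa using (congrArg List.length huv).symm
    have hget (j : ℕ) (hj : j < n) :
        a ⟨j, hj⟩ = (u ++ (k + 1) :: v)[j]'(by simp; omega) := by
      simp [← huv]
    have hai : a ⟨u.length, by omega⟩ = k + 1 := by rw [hget]; simp
    obtain ⟨⟨i₁, hi₁, h₁⟩, i₂, hi₂, h₂⟩ := h ⟨u.length, by omega⟩ (by omega) (by
      intro j hj
      by_contra! hlt
      have hlt' : j.1 < u.length := hlt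
      rw [hai, ← Fin.eta j j.2, hget, List.getElem_append_left hlt'] at hj
      exact hk (hj ▸ List.getElem_mem _))
    rw [hai] at h₁ h₂
    constructor
    · have hlt : i₁.1 < u.length := hi₁
      rw [← Fin.eta i₁ i₁.2, hget, List.getElem_append_left hlt] at h₁
      exact Nat.succ.inj h₁ ▸ List.getElem_mem _
    · have hlt : u.length < i₂.1 := hi₂
      obtain ⟨m, hm⟩ := Nat.exists_eq_add_of_lt hlt
      have := hget i₂.1 i₂.2
      simp only [hm, Nat.add_assoc, List.getElem_append_right (Nat.le_add_right _ _),
        Nat.add_sub_cancel_left, List.getElem_cons_succ] at this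
      rw [show (⟨u.length + (m + 1), by omega⟩ : Fin n) = i₂ from Fin.ext (by simp; omega)] at this
      exact (this.symm.trans (Nat.succ.inj h₂)) ▸ List.getElem_mem _
  · obtain ⟨k, hk⟩ := Nat.exists_eq_succ_of_ne_zero hi.ne'
    have hlen : i.1 < (List.ofFn a).length := by simp
    have := h ((List.ofFn a).take i) ((List.ofFn a).drop (i + 1)) k (by
      conv_lhs => rw [← List.take_append_drop i (List.ofFn a), List.drop_eq_getElem_cons hlen]
      simp [hk]) (by
      intro hmem
      obtain ⟨j, hj, hjk⟩ := List.mem_take_iff_getElem.1 hmem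
      rw [List.getElem_ofFn] at hjk
      have := hmin _ (hjk.trans hk.symm)
      rw [Fin.le_def] at this
      simp at this hj
      omega)
    obtain ⟨h₁, h₂⟩ := this
    obtain ⟨j, hj, hjk⟩ := List.mem_take_iff_getElem.1 h₁
    obtain ⟨m, hm, hmk⟩ := List.mem_drop_iff_getElem.1 h₂
    rw [List.getElem_ofFn] at hjk hmk
    refine ⟨⟨_, ?_, by rw [hjk, hk]⟩, ⟨_, ?_, by rw [hmk, hk]⟩⟩
    · simp at hj
      rw [Fin.lt_def]
      omega
    · rw [Fin.lt_def]
      simp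
      omega

lemma countEq_eq_count_ofFn {n : ℕ} (a : Fin n → ℕ) (c : ℕ) :
    countEq a c = (List.ofFn a).count c := by
  rw [countEq, Set.ncard_eq_toFinset_card', ← Multiset.coe_count, ← Fin.univ_val_map,
    Multiset.count_map, Finset.card_def, Set.toFinset_ofPred, Finset.filter_val]
  simp only [eq_comm]

lemma numLet_eq_ncard (i n s t : ℕ) :
    numLet i n s t =
      {L | (IsCatalanList L ∧ L.length = n) ∧ L.count i = s ∧ L.count 0 = t}.ncard := by
  rw [numLet, ← Set.ncard_image_of_injective _ List.ofFn_injective]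
  congr 1
  ext L
  simp only [Set.mem_image, Set.mem_ofPred_eq, isCatalanWord_iff, countEq_eq_count_ofFn]
  constructor
  · rintro ⟨a, ⟨h1, h2, h3⟩, rfl⟩
    exact ⟨⟨h1, by simp⟩, h2, h3⟩
  · rintro ⟨⟨h1, rfl⟩, h2, h3⟩
    exact ⟨L.get, by simpa using ⟨h1, h2, h3⟩, List.ofFn_get L⟩

lemma numLet_self {i t : ℕ} (hi : 1 ≤ i) : numLet i t 0 t = 1 := by
  rw [numLet_eq_ncard, Set.ncard_eq_one]
  refine ⟨List.replicate t 0,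
    Set.eq_singleton_iff_unique_mem.2 ⟨⟨⟨⟨?_, ?_⟩, by simp⟩, ?_, by simp⟩, ?_⟩⟩
  · exact List.isChain_replicate_of_rel _ (by simp)
  · intro u v k h
    have : k + 1 ∈ List.replicate t 0 := by simp [h]
    simp at this
  · rw [List.count_replicate, if_neg]
    simp
    omega
  · rintro L ⟨⟨-, h1⟩, -, h2⟩
    rw [← h2, eq_comm, List.replicate_count_eq_of_count_eq_length]
    omega

lemma numLet_succ_add (i t m : ℕ) (hm : m ≠ 0) :
    numLet (i + 1) (m + (t + 1)) 0 (t + 1) = ∑ l ∈ Finset.Icc 1 m,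
      ((l + t).choose l - 1) * numLet i m 0 l := by
  classical
  have hfinB : {b | (IsCatalanList b ∧ b.length = m) ∧ b.count i = 0}.Finite :=
    (finite_isCatalanList m).subset fun _ h => h.1
  have hfinA : {a | (IsCatalanList a ∧ a.length = m + (t + 1)) ∧ a.count (i + 1) = 0 ∧
      a.count 0 = t + 1}.Finite :=
    (finite_isCatalanList (m + (t + 1))).subset fun _ h => h.1
  rw [numLet_eq_ncard, Set.ncard_eq_toFinset_card _ hfinA,
    Finset.card_eq_sum_card_fiberwise (f := lowerNonzero) (t := hfinB.toFinset)]
  swap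
  · intro a ha
    simp only [Set.Finite.coe_toFinset, Set.mem_ofPred_eq] at ha ⊢
    obtain ⟨⟨h1, h2⟩, h3, h4⟩ := ha
    refine ⟨⟨h1.lowerNonzero, ?_⟩, by rw [count_lowerNonzero, h3]⟩
    have := length_eq_count_zero_add_length_lowerNonzero a
    omega
  have hfib (b : List ℕ) (hb : b ∈ hfinB.toFinset) :
      (hfinA.toFinset.filter (lowerNonzero · = b)).card =
        (b.count 0 + t).choose (b.count 0) - 1 := by
    simp only [Set.Finite.mem_toFinset, Set.mem_ofPred_eq] at hb
    obtain ⟨⟨h1, h2⟩, h3⟩ := hb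
    have hne : b ≠ [] := by
      rintro rfl
      exact hm h2.symm
    rw [← Nat.cast_inj (R := ℕ∞), ← encard_fiber_lowerNonzero h1 hne,
      ← Set.encard_coe_eq_coe_finsetCard]
    congr 1
    ext a
    simp only [Finset.coe_filter, Set.Finite.mem_toFinset, Set.mem_ofPred_eq]
    constructor
    · rintro ⟨⟨⟨h4, h5⟩, h6, h7⟩, h8⟩
      exact ⟨h4, h8, h7⟩
    · rintro ⟨h4, rfl, h7⟩
      refine ⟨⟨⟨h4, ?_⟩, by rw [← count_lowerNonzero, h3], h7⟩, rfl⟩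
      have := length_eq_count_zero_add_length_lowerNonzero a
      omega
  rw [Finset.sum_congr rfl hfib,
    ← Finset.sum_fiberwise_of_maps_to (t := Finset.Icc 1 m) (g := List.count 0)]
  swap
  · intro b hb
    simp only [Set.Finite.mem_toFinset, Set.mem_ofPred_eq] at hb
    obtain ⟨⟨h1, rfl⟩, h3⟩ := hb
    rw [Finset.mem_Icc]
    refine ⟨?_, List.count_le_length⟩
    cases b with
    | nil => simp at hm
    | cons x b => simp [h1.head_eq_zero]
  refine Finset.sum_congr rfl fun l _ => ?_
  rw [Finset.sum_congr rfl (g := fun _ => (l + t).choose l - 1)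
    (fun b hb => by rw [(Finset.mem_filter.1 hb).2]), Finset.sum_const, smul_eq_mul, mul_comm,
    numLet_eq_ncard, ← Set.ncard_coe_finset]
  congr 2
  ext b
  simp [and_assoc]

/-- Recurrence for `aᵢ(n,0,t)` for `i ≥ 1` and `1 ≤ t ≤ n`:
`aᵢ(n,0,t) = δ_{n,t} + Σ_{ℓ=1}^{n-t} (C(ℓ+t-1,ℓ) - 1)·a_{i-1}(n-t,0,ℓ)`.
(When `i = 1`, the terms `a₀(n-t,0,ℓ)` with `ℓ ≥ 1` vanish, since no word has
simultaneously `0` zeros and `ℓ ≥ 1` zeros.) -/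
theorem numLet_zero_recurrence (i t n : ℕ) (hi : 1 ≤ i) (ht1 : 1 ≤ t) (htn : t ≤ n) :
    numLet i n 0 t = (if n = t then 1 else 0) + ∑ l ∈ Finset.Icc 1 (n - t),
      (Nat.choose (l + t - 1) l - 1) * numLet (i - 1) (n - t) 0 l := by
  obtain ⟨i, rfl⟩ := Nat.exists_eq_add_of_le' hi
  obtain ⟨t, rfl⟩ := Nat.exists_eq_add_of_le' ht1
  obtain ⟨m, rfl⟩ := Nat.exists_eq_add_of_le' htn
  rcases eq_or_ne m 0 with rfl | hm
  · simp [numLet_self]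
  · rw [numLet_succ_add i t m hm, if_neg (by omega), zero_add]
    simp [← Nat.add_assoc]
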